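/- Let g : ℝ^{n−1} ∖ {0} → ℂ be smooth and positively homogeneous of degree 0 (g(λy) = g(y) for all λ > 0). Define h(x) = (2i·|x'|)^{−(n−2)/2} · g(x') on {x ∈ ℝⁿ : x' ≠ 0}, the complex power taken via the principal branch. Then h satisfies L h = 0, where L = 4∂_z̄ − 2(n−2)/(z − z̄); that is, for every x with x' ≠ 0, 4·∂_z̄h(x) = (2(n−2)/(2i|x'|))·h(x), where ∂_z̄h(x) := ½·( ∂h/∂x₁(x) + i·(x'/|x'|)·∇_{x'}h(x) ). Consequently, for every τ ∈ ℝ, Δ(z^τ h)(x) = z(x)^τ · Δh(x) for all x with x' ≠ 0. -/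

import Mathlib

open MeasureTheory Complex

noncomputable section

/-- `ℝⁿ` split as `ℝ × ℝ^{n-1}`. -/
abbrev Spc (m : ℕ) := ℝ × EuclideanSpace ℝ (Fin m)

/-- `z(x) = x₁ + i |x'|`. -/
def zf {m : ℕ} (x : Spc m) : ℂ := (x.1 : ℂ) + Complex.I * (‖x.2‖ : ℝ)

/-- The Euclidean Laplacian, as the sum of second directional derivatives along the
standard orthonormal basis of `ℝ × ℝ^m`. -/
def lap {m : ℕ} (f : Spc m → ℂ) (x : Spc m) : ℂ :=
  fderiv ℝ (fun y => fderiv ℝ f y ((1 : ℝ), 0)) x ((1 : ℝ), 0)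
  + ∑ i : Fin m, fderiv ℝ (fun y => fderiv ℝ f y (0, EuclideanSpace.single i (1 : ℝ))) x
      (0, EuclideanSpace.single i (1 : ℝ))

/-- `∂_z̄ f(x) = ½ (∂f/∂x₁(x) + i (x'/|x'|)·∇_{x'} f(x))`. -/
def dbar {m : ℕ} (f : Spc m → ℂ) (x : Spc m) : ℂ :=
  (1 / 2 : ℂ) * (fderiv ℝ f x ((1 : ℝ), 0) + Complex.I * fderiv ℝ f x (0, ‖x.2‖⁻¹ • x.2))

lemma isOpen_snd_ne_zero (m : ℕ) : IsOpen {x : Spc m | x.2 ≠ 0} :=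
  isOpen_ne.preimage continuous_snd

lemma eventually_snd_ne_zero {m : ℕ} {x : Spc m} (hx : x.2 ≠ 0) :
    ∀ᶠ y : Spc m in nhds x, y.2 ≠ 0 :=
  (isOpen_snd_ne_zero m).mem_nhds hx

lemma ContDiffAt.differentiableAt_fderiv_apply {m : ℕ} {f : Spc m → ℂ} {x : Spc m}
    (hf : ContDiffAt ℝ 2 f x) (v : Spc m) :
    DifferentiableAt ℝ (fun y => fderiv ℝ f y v) x := by
  have h1 : ContDiffAt ℝ 1 (fderiv ℝ f) x := hf.fderiv_right (by norm_num)
  exact (h1.differentiableAt (by norm_num)).clm_apply (differentiableAt_const v)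

/-- Leibniz rule for the second derivative in a fixed direction. -/
lemma fderiv_fderiv_mul_apply {m : ℕ} {u f : Spc m → ℂ} {x : Spc m}
    (hu : ContDiffAt ℝ 2 u x) (hf : ContDiffAt ℝ 2 f x) (v : Spc m) :
    fderiv ℝ (fun y => fderiv ℝ (fun w => u w * f w) y v) x v =
      u x * fderiv ℝ (fun y => fderiv ℝ f y v) x v
      + 2 * (fderiv ℝ u x v * fderiv ℝ f x v)
      + f x * fderiv ℝ (fun y => fderiv ℝ u y v) x v := by
  have hev : (fun y => fderiv ℝ (fun w => u w * f w) y v) =ᶠ[nhds x]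
      fun y => u y * fderiv ℝ f y v + f y * fderiv ℝ u y v := by
    filter_upwards [hu.eventually (by simp), hf.eventually (by simp)] with y h1 h2
    rw [fderiv_fun_mul (h1.differentiableAt (by simp)) (h2.differentiableAt (by simp))]
    simp
  have du := hu.differentiableAt (by simp)
  have df := hf.differentiableAt (by simp)
  have ddu := hu.differentiableAt_fderiv_apply v
  have ddf := hf.differentiableAt_fderiv_apply v
  rw [hev.fderiv_eq, fderiv_fun_add (du.fun_mul ddf) (df.fun_mul ddu),
    fderiv_fun_mul du ddf, fderiv_fun_mul df ddu]
  simp only [add_apply, smul_apply, smul_eq_mul]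
  ring

lemma contDiffAt_ofReal_norm_snd {m : ℕ} {x : Spc m} (hx : x.2 ≠ 0) :
    ContDiffAt ℝ 2 (fun y : Spc m => ((‖y.2‖ : ℝ) : ℂ)) x :=
  Complex.ofRealCLM.contDiff.contDiffAt.comp x (contDiffAt_snd.norm ℝ hx)

lemma contDiffAt_zf {m : ℕ} {x : Spc m} (hx : x.2 ≠ 0) : ContDiffAt ℝ 2 (zf (m := m)) x :=
  (Complex.ofRealCLM.contDiff.contDiffAt.comp x contDiffAt_fst).add
    (contDiffAt_const.mul (contDiffAt_ofReal_norm_snd hx))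

lemma zf_mem_slitPlane {m : ℕ} {x : Spc m} (hx : x.2 ≠ 0) : zf x ∈ Complex.slitPlane := by
  refine Or.inr ?_
  simpa [zf] using hx

lemma contDiffAt_cpow_const {c w : ℂ} (hw : w ∈ Complex.slitPlane) :
    ContDiffAt ℝ 2 (fun y : ℂ => y ^ c) w := by
  have hA : AnalyticAt ℂ (fun y : ℂ => y ^ c) w := analyticAt_id.cpow analyticAt_const hw
  exact hA.contDiffAt.restrict_scalars ℝ

/-- The derivative of `|x'|` in a fixed direction. -/
lemma fderiv_norm_snd_apply {m : ℕ} {x : Spc m} (hx : x.2 ≠ 0) (v : Spc m) :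
    fderiv ℝ (fun y : Spc m => ‖y.2‖) x v = inner ℝ x.2 v.2 / ‖x.2‖ := by
  have hd : DifferentiableAt ℝ (fun y : Spc m => ‖y.2‖) x :=
    differentiableAt_snd.norm ℝ hx
  have h1 := (hd.hasFDerivAt.mul hd.hasFDerivAt)
  have h2 := (hasFDerivAt_snd (𝕜 := ℝ) (p := x)).norm_sq
  have he : (fun y : Spc m => ‖y.2‖ ^ 2) = (fun y : Spc m => ‖y.2‖) * fun y => ‖y.2‖ := by
    ext y; simp [sq]
  rw [he] at h2
  have := congrArg (fun L => L v) (h1.unique h2)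
  have hn : ‖x.2‖ ≠ 0 := norm_ne_zero_iff.2 hx
  simp at this
  field_simp
  linarith

lemma fderiv_zf_apply {m : ℕ} {x : Spc m} (hx : x.2 ≠ 0) (v : Spc m) :
    fderiv ℝ (zf (m := m)) x v =
      (v.1 : ℂ) + Complex.I * ((inner ℝ x.2 v.2 / ‖x.2‖ : ℝ) : ℂ) := by
  have hd : DifferentiableAt ℝ (fun y : Spc m => ‖y.2‖) x := differentiableAt_snd.norm ℝ hx
  have h1 := Complex.ofRealCLM.hasFDerivAt.comp x (hasFDerivAt_fst (𝕜 := ℝ) (p := x))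
  have h2 := Complex.ofRealCLM.hasFDerivAt.comp x hd.hasFDerivAt
  have h3 := h1.add (h2.const_mul Complex.I)
  have h4 : HasFDerivAt (zf (m := m)) _ x := h3
  rw [h4.fderiv]
  simp [fderiv_norm_snd_apply hx]

lemma fderiv_fderiv_zf_apply {m : ℕ} {x : Spc m} (hx : x.2 ≠ 0) (v : Spc m) :
    fderiv ℝ (fun y => fderiv ℝ (zf (m := m)) y v) x v =
      Complex.I * ((inner ℝ v.2 v.2 / ‖x.2‖ - inner ℝ x.2 v.2 ^ 2 / ‖x.2‖ ^ 3 : ℝ) : ℂ) := by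
  have hev : (fun y => fderiv ℝ (zf (m := m)) y v) =ᶠ[nhds x]
      fun y => (v.1 : ℂ) + Complex.I * ((inner ℝ y.2 v.2 * ‖y.2‖⁻¹ : ℝ) : ℂ) := by
    filter_upwards [eventually_snd_ne_zero hx] with y hy
    rw [fderiv_zf_apply hy, div_eq_mul_inv]
  have hn : ‖x.2‖ ≠ 0 := norm_ne_zero_iff.2 hx
  have hd : DifferentiableAt ℝ (fun y : Spc m => ‖y.2‖) x := differentiableAt_snd.norm ℝ hx
  have h1 := (hasFDerivAt_snd (𝕜 := ℝ) (p := x)).inner ℝ (hasFDerivAt_const v.2 x)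
  have h2 := (hasDerivAt_inv hn).comp_hasFDerivAt x hd.hasFDerivAt
  have h3 := Complex.ofRealCLM.hasFDerivAt.comp x (h1.mul h2)
  have h4 : HasFDerivAt (fun y : Spc m =>
    (v.1 : ℂ) + Complex.I * ((inner ℝ y.2 v.2 * ‖y.2‖⁻¹ : ℝ) : ℂ)) _ x :=
    (h3.const_mul Complex.I).const_add (v.1 : ℂ)
  rw [hev.fderiv_eq, h4.fderiv]
  have hnc : ((‖x.2‖ : ℝ) : ℂ) ≠ 0 := by exact_mod_cast hn
  simp [fderiv_norm_snd_apply hx]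
  field_simp
  ring

lemma fderiv_zf_cpow_apply {m : ℕ} {x : Spc m} (hx : x.2 ≠ 0) (c : ℂ) (v : Spc m) :
    fderiv ℝ (fun y : Spc m => zf y ^ c) x v = c * zf x ^ (c - 1) * fderiv ℝ zf x v := by
  have h1 := ((hasDerivAt_id (zf x)).cpow_const (c := c)
    (zf_mem_slitPlane hx)).hasFDerivAt.restrictScalars ℝ
  have h2 : HasFDerivAt (fun y : Spc m => zf y ^ c) _ x :=
    h1.comp x ((contDiffAt_zf hx).differentiableAt (by simp)).hasFDerivAt
  rw [h2.fderiv]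
  simp
  ring

lemma contDiffAt_zf_cpow {m : ℕ} {x : Spc m} (hx : x.2 ≠ 0) (c : ℂ) :
    ContDiffAt ℝ 2 (fun y : Spc m => zf y ^ c) x :=
  (contDiffAt_cpow_const (zf_mem_slitPlane hx)).comp x (contDiffAt_zf hx)

lemma fderiv_fderiv_zf_cpow_apply {m : ℕ} {x : Spc m} (hx : x.2 ≠ 0) (c : ℂ) (v : Spc m) :
    fderiv ℝ (fun y => fderiv ℝ (fun w : Spc m => zf w ^ c) y v) x v =
      c * (c - 1) * zf x ^ (c - 1 - 1) * fderiv ℝ zf x v ^ 2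
      + c * zf x ^ (c - 1) * fderiv ℝ (fun y => fderiv ℝ zf y v) x v := by
  have hev : (fun y => fderiv ℝ (fun w : Spc m => zf w ^ c) y v) =ᶠ[nhds x]
      fun y => c * (zf y ^ (c - 1) * fderiv ℝ zf y v) := by
    filter_upwards [eventually_snd_ne_zero hx] with y hy
    rw [fderiv_zf_cpow_apply hy, mul_assoc]
  have h1 := (contDiffAt_zf_cpow hx (c - 1)).differentiableAt (by simp)
  have h2 := (contDiffAt_zf hx).differentiableAt_fderiv_apply v
  rw [hev.fderiv_eq, fderiv_const_mul (h1.fun_mul h2), fderiv_fun_mul h1 h2]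
  simp only [add_apply, smul_apply, smul_eq_mul,
    fderiv_zf_cpow_apply hx]
  ring

lemma lap_zf_cpow {m : ℕ} {x : Spc m} (hx : x.2 ≠ 0) (c : ℂ) :
    lap (fun y : Spc m => zf y ^ c) x =
      c * zf x ^ (c - 1) * (Complex.I * (((m : ℂ) - 1) / (‖x.2‖ : ℝ))) := by
  have hn : ((‖x.2‖ : ℝ) : ℂ) ≠ 0 := by exact_mod_cast norm_ne_zero_iff.2 hx
  have hs : ∑ i, ((x.2 i : ℝ) : ℂ) ^ 2 = ((‖x.2‖ : ℝ) : ℂ) ^ 2 := by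
    rw [← Complex.ofReal_pow, EuclideanSpace.real_norm_sq_eq]
    push_cast
    rfl
  have hterm : ∀ i : Fin m,
      fderiv ℝ (fun y => fderiv ℝ (fun w : Spc m => zf w ^ c) y
        (0, EuclideanSpace.single i (1 : ℝ))) x (0, EuclideanSpace.single i (1 : ℝ)) =
      (-(c * (c - 1) * zf x ^ (c - 1 - 1) / (‖x.2‖ : ℝ) ^ 2)
        - c * zf x ^ (c - 1) * Complex.I / (‖x.2‖ : ℝ) ^ 3) * ((x.2 i : ℝ) : ℂ) ^ 2
      + c * zf x ^ (c - 1) * Complex.I / (‖x.2‖ : ℝ) := by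
    intro i
    rw [fderiv_fderiv_zf_cpow_apply hx, fderiv_zf_apply hx, fderiv_fderiv_zf_apply hx]
    simp [EuclideanSpace.inner_single_right, mul_pow]
    field_simp
    ring
  unfold lap
  rw [fderiv_fderiv_zf_cpow_apply hx, fderiv_zf_apply hx, fderiv_fderiv_zf_apply hx]
  simp_rw [hterm]
  rw [Finset.sum_add_distrib, ← Finset.mul_sum, hs]
  simp
  field_simp
  ring

lemma sum_fderiv_zf_cpow_mul_fderiv {m : ℕ} {x : Spc m} (hx : x.2 ≠ 0) (c : ℂ)
    (f : Spc m → ℂ) :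
    fderiv ℝ (fun y : Spc m => zf y ^ c) x (1, 0) * fderiv ℝ f x (1, 0)
      + ∑ i : Fin m, fderiv ℝ (fun y : Spc m => zf y ^ c) x (0, EuclideanSpace.single i (1 : ℝ))
          * fderiv ℝ f x (0, EuclideanSpace.single i (1 : ℝ)) =
      c * zf x ^ (c - 1) * (2 * dbar f x) := by
  have hv : ((0 : ℝ), ‖x.2‖⁻¹ • x.2) =
      ∑ i : Fin m, (‖x.2‖⁻¹ * x.2 i) • ((0 : ℝ), EuclideanSpace.single i (1 : ℝ)) := by
    ext j
    · simp [Prod.fst_sum]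
    · simp [Prod.snd_sum, Finset.sum_apply, Pi.single_apply]
  unfold dbar
  rw [hv, map_sum]
  simp_rw [fderiv_zf_cpow_apply hx, fderiv_zf_apply hx, map_smul]
  simp only [inner_zero_right, EuclideanSpace.inner_single_right]
  simp only [Complex.real_smul, mul_add, Finset.mul_sum]
  congr 1
  · simp
  · refine Finset.sum_congr rfl fun i _ => ?_
    simp
    ring

/-- Product rule for the Laplacian of `z ^ c * f`. -/
lemma lap_zf_cpow_mul {m : ℕ} {x : Spc m} (hx : x.2 ≠ 0) (c : ℂ) {f : Spc m → ℂ}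
    (hf : ContDiffAt ℝ 2 f x) :
    lap (fun y => zf y ^ c * f y) x =
      zf x ^ c * lap f x + c * zf x ^ (c - 1) *
        (4 * dbar f x + Complex.I * (((m : ℂ) - 1) / (‖x.2‖ : ℝ)) * f x) := by
  have h1 := lap_zf_cpow hx c
  have h2 := sum_fderiv_zf_cpow_mul_fderiv hx c f
  unfold lap at h1 ⊢
  simp_rw [fderiv_fderiv_mul_apply (contDiffAt_zf_cpow hx c) hf]
  simp only [Finset.sum_add_distrib, ← Finset.mul_sum]
  linear_combination f x * h1 + 2 * h2

lemma two_I_norm_mem_slitPlane {r : ℝ} (hr : r ≠ 0) :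
    2 * Complex.I * (r : ℂ) ∈ Complex.slitPlane := by
  refine Or.inr ?_
  simpa using hr

lemma fderiv_fst_eq_zero {m : ℕ} {f : Spc m → ℂ} {x : Spc m} (hf : DifferentiableAt ℝ f x)
    (hc : ∀ t : ℝ, f (t, x.2) = f x) : fderiv ℝ f x (1, 0) = 0 := by
  rw [← hf.lineDeriv_eq_fderiv, lineDeriv]
  have : (fun t : ℝ => f (x + t • ((1 : ℝ), (0 : EuclideanSpace ℝ (Fin m))))) = fun _ => f x := by
    ext t
    rw [← hc (x.1 + t)]
    congr 1
    ext <;> simp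
  rw [this, deriv_const]

/-- The radial derivative of `(2i|x'|) ^ c * g x'` for `g` homogeneous of degree `0`. -/
lemma fderiv_radial {m : ℕ} {g : EuclideanSpace ℝ (Fin m) → ℂ}
    (hg : ∀ c : ℝ, 0 < c → ∀ y, g (c • y) = g y) {c : ℂ} {f : Spc m → ℂ}
    (hf : ∀ x : Spc m, f x = (2 * Complex.I * (‖x.2‖ : ℝ)) ^ c * g x.2)
    {x : Spc m} (hx : x.2 ≠ 0) (hd : DifferentiableAt ℝ f x) :
    fderiv ℝ f x (0, ‖x.2‖⁻¹ • x.2) = c / (‖x.2‖ : ℝ) * f x := by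
  have hr : 0 < ‖x.2‖ := norm_pos_iff.2 hx
  have hrc : ((‖x.2‖ : ℝ) : ℂ) ≠ 0 := by exact_mod_cast hr.ne'
  have hev : (fun t : ℝ => f (x + t • ((0 : ℝ), ‖x.2‖⁻¹ • x.2))) =ᶠ[nhds 0]
      fun t : ℝ => (2 * Complex.I * ((‖x.2‖ + t : ℝ) : ℂ)) ^ c * g x.2 := by
    filter_upwards [lt_mem_nhds (neg_lt_zero.2 hr)] with t ht
    have hpos : 0 < 1 + t * ‖x.2‖⁻¹ := by
      have : 0 < (‖x.2‖ + t) * ‖x.2‖⁻¹ := mul_pos (by linarith) (inv_pos.2 hr)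
      rwa [add_mul, mul_inv_cancel₀ hr.ne'] at this
    have h2 : (x + t • ((0 : ℝ), ‖x.2‖⁻¹ • x.2)).2 = (1 + t * ‖x.2‖⁻¹) • x.2 := by
      simp [add_smul, smul_smul]
    rw [hf, h2, hg _ hpos, norm_smul, Real.norm_of_nonneg hpos.le, add_mul, one_mul,
      inv_mul_cancel_right₀ hr.ne']
  have h1 : HasDerivAt (fun t : ℝ => 2 * Complex.I * ((‖x.2‖ + t : ℝ) : ℂ))
      (2 * Complex.I * ((1 : ℝ) : ℂ)) 0 :=
    (((hasDerivAt_id (0 : ℝ)).const_add ‖x.2‖).ofReal_comp).const_mul _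
  have hs : 2 * Complex.I * ((‖x.2‖ + 0 : ℝ) : ℂ) ∈ Complex.slitPlane :=
    two_I_norm_mem_slitPlane (by simpa using hx)
  have h2 := (((hasDerivAt_id _).cpow_const (c := c) hs).comp (0 : ℝ) h1).mul_const (g x.2)
  have h3 : HasDerivAt (fun t : ℝ => (2 * Complex.I * ((‖x.2‖ + t : ℝ) : ℂ)) ^ c * g x.2) _ 0 := h2
  rw [← hd.lineDeriv_eq_fderiv, lineDeriv, hev.deriv_eq, h3.deriv, hf]
  have h0 : 2 * Complex.I * ((‖x.2‖ : ℝ) : ℂ) ≠ 0 := by simp [hx]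
  simp only [add_zero, id]
  rw [Complex.cpow_sub _ _ h0, Complex.cpow_one]
  have := Complex.I_ne_zero
  simp
  field_simp

/-- The function `h(x) = (2i|x'|)^{-(n-2)/2} g(x')`, for `g` smooth and homogeneous of degree `0`,
satisfies `L h = 0` where `L = 4∂_z̄ - 2(n-2)/(z - z̄)`; consequently
`Δ(z^τ h) = z^τ Δh` for every `τ`. -/
theorem Lh_eq_zero (n : ℕ) (hn : 3 ≤ n)
    (g : EuclideanSpace ℝ (Fin (n - 1)) → ℂ)
    (hg : ContDiffOn ℝ (⊤ : ℕ∞) g {y | y ≠ 0})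
    (hghom : ∀ c : ℝ, 0 < c → ∀ y : EuclideanSpace ℝ (Fin (n - 1)), g (c • y) = g y)
    (h : Spc (n - 1) → ℂ)
    (hdef : ∀ x : Spc (n - 1),
      h x = (2 * Complex.I * (‖x.2‖ : ℝ)) ^ (-(((n : ℂ) - 2) / 2)) * g x.2) :
    (∀ x : Spc (n - 1), x.2 ≠ 0 →
        4 * dbar h x = (2 * ((n : ℂ) - 2) / (2 * Complex.I * (‖x.2‖ : ℝ))) * h x) ∧
    (∀ τ : ℝ, ∀ x : Spc (n - 1), x.2 ≠ 0 →
        lap (fun y => zf y ^ (τ : ℂ) * h y) x = zf x ^ (τ : ℂ) * lap h x) := by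
  have hsm : ∀ x : Spc (n - 1), x.2 ≠ 0 → ContDiffAt ℝ 2 h x := by
    intro x hx
    have hg2 : ContDiffAt ℝ 2 g x.2 :=
      (hg.contDiffAt (isOpen_ne.mem_nhds hx)).of_le (WithTop.coe_le_coe.2 (le_top : (2 : ℕ∞) ≤ ⊤))
    have hs := two_I_norm_mem_slitPlane (norm_ne_zero_iff.2 hx)
    rw [funext hdef]
    exact ((contDiffAt_cpow_const hs).comp x
      (contDiffAt_const.mul (contDiffAt_ofReal_norm_snd hx))).mul (hg2.comp x contDiffAt_snd)
  have hL : ∀ x : Spc (n - 1), x.2 ≠ 0 →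
      4 * dbar h x = (2 * ((n : ℂ) - 2) / (2 * Complex.I * (‖x.2‖ : ℝ))) * h x := by
    intro x hx
    have hd := (hsm x hx).differentiableAt (by simp)
    have hrc : ((‖x.2‖ : ℝ) : ℂ) ≠ 0 := by exact_mod_cast norm_ne_zero_iff.2 hx
    rw [dbar, fderiv_fst_eq_zero hd (fun t => by rw [hdef, hdef]), fderiv_radial hghom hdef hx hd]
    have := Complex.I_ne_zero
    field_simp
    linear_combination (-4 * ((n : ℂ) - 2) * h x) * Complex.I_sq
  refine ⟨hL, fun τ x hx => ?_⟩
  have hrc : ((‖x.2‖ : ℝ) : ℂ) ≠ 0 := by exact_mod_cast norm_ne_zero_iff.2 hx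
  have hz : 4 * dbar h x + Complex.I * ((((n - 1 : ℕ) : ℂ) - 1) / (‖x.2‖ : ℝ)) * h x = 0 := by
    rw [hL x hx, Nat.cast_sub (by omega)]
    have := Complex.I_ne_zero
    push_cast
    field_simp
    rw [Complex.I_sq]
    ring
  rw [lap_zf_cpow_mul hx _ (hsm x hx), hz, mul_zero, add_zero]
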